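/- arXiv:1910.04752 — 2 statements merged into one kernel-verified Lean document; each statement's English description precedes it below -/
import Mathlib

section
/- For every smooth function f : ℝ → ℝ that is even (f(x) = f(-x) for all x), there exists a smooth function g : ℝ → ℝ such that f(x) = g(x²) for all x ∈ ℝ. -/
open Filter Topology in
lemma contDiff_of_seq (G : ℕ → ℝ → ℝ) (h : ∀ k x, HasDerivAt (G k) (G (k+1) x) x) :
    ∀ k, ContDiff ℝ (⊤ : ℕ∞) (G k) := by
  have key : ∀ n : ℕ, ∀ k, ContDiff ℝ n (G k) := by
    intro n
    induction n with
    | zero =>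
      intro k
      exact contDiff_zero.2 (continuous_iff_continuousAt.2 fun x => (h k x).continuousAt)
    | succ n ih =>
      intro k
      have hd : deriv (G k) = G (k+1) := funext fun x => (h k x).deriv
      push_cast
      rw [contDiff_succ_iff_deriv]
      refine ⟨fun x => (h k x).differentiableAt, by simp, ?_⟩
      rw [hd]; exact ih _
  intro k
  exact contDiff_infty.2 fun n => key n k

lemma hasDerivAt_iter (F : ℝ → ℝ) (hF : ContDiff ℝ (⊤ : ℕ∞) F) (k : ℕ) (x : ℝ) :
    HasDerivAt (iteratedDeriv k F) (iteratedDeriv (k+1) F x) x := by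
  rw [iteratedDeriv_succ]
  exact ((hF.differentiable_iteratedDeriv k (by exact_mod_cast ENat.natCast_lt_top k)) x).hasDerivAt

open Filter Topology in
lemma hasDerivAt_J (F : ℝ → ℝ) (hF : ContDiff ℝ (⊤ : ℕ∞) F) (k : ℕ) (x : ℝ) :
    HasDerivAt (fun x => ∫ t in (0:ℝ)..1, t^k * iteratedDeriv k F (t*x))
      (∫ t in (0:ℝ)..1, t^(k+1) * iteratedDeriv (k+1) F (t*x)) x := by
  have hc : ∀ k, Continuous (iteratedDeriv k F) := fun k =>
    continuous_iff_continuousAt.2 fun x => (hasDerivAt_iter F hF k x).continuousAt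
  have hcc : ∀ k (x : ℝ), Continuous fun t : ℝ => t^k * iteratedDeriv k F (t*x) := fun k x =>
    (continuous_id.pow k).mul ((hc k).comp (continuous_id.mul continuous_const))
  obtain ⟨C, hC⟩ := (isCompact_Icc (a := -(|x|+1)) (b := |x|+1)).exists_bound_of_continuousOn
    (hc (k+1)).continuousOn
  refine (intervalIntegral.hasDerivAt_integral_of_dominated_loc_of_deriv_le
    (F' := fun x t => t^(k+1) * iteratedDeriv (k+1) F (t*x)) (bound := fun _ => C)
    (Metric.ball_mem_nhds x one_pos) (Eventually.of_forall fun y => (hcc k y).aestronglyMeasurable)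
    ((hcc k x).intervalIntegrable _ _) (hcc (k+1) x).aestronglyMeasurable ?_ (by simp) ?_).2
  · refine Eventually.of_forall fun t ht y hy => ?_
    rw [Set.uIoc_of_le zero_le_one] at ht
    have hy1 : |y| ≤ |x| + 1 := by
      have h1 : |y - x| < 1 := by simpa [Real.dist_eq] using hy
      have := abs_sub_abs_le_abs_sub y x
      linarith
    have h2 : |t * y| ≤ |x| + 1 := by
      rw [abs_mul, abs_of_pos ht.1]
      exact (mul_le_of_le_one_left (abs_nonneg _) ht.2).trans hy1
    have h3 := hC (t*y) (abs_le.1 h2)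
    rw [norm_mul]
    refine (mul_le_of_le_one_left (norm_nonneg _) ?_).trans h3
    rw [Real.norm_eq_abs, abs_of_pos (pow_pos ht.1 _)]
    exact pow_le_one₀ ht.1.le ht.2
  · refine Eventually.of_forall fun t ht y hy => ?_
    have h1 : HasDerivAt (fun y : ℝ => t * y) t y := by
      simpa using (hasDerivAt_id y).const_mul t
    have h2 := ((hasDerivAt_iter F hF k (t*y)).comp y h1).const_mul (t^k)
    exact h2.congr_deriv (by ring)

lemma hadamard (f : ℝ → ℝ) (hf : ContDiff ℝ (⊤ : ℕ∞) f) (h0 : f 0 = 0) :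
    ∃ q : ℝ → ℝ, ContDiff ℝ (⊤ : ℕ∞) q ∧ ∀ x, f x = x * q x := by
  have hd : ContDiff ℝ (⊤ : ℕ∞) (deriv f) := (contDiff_infty_iff_deriv.1 hf).2
  refine ⟨_, contDiff_of_seq (fun k x => ∫ t in (0:ℝ)..1, t^k * iteratedDeriv k (deriv f) (t*x))
    (fun k x => hasDerivAt_J _ hd k x) 0, fun x => ?_⟩
  have h1 : ∀ t ∈ Set.uIcc (0:ℝ) 1, HasDerivAt (fun t => f (t * x)) (x * deriv f (t*x)) t := by
    intro t _
    have h1 : HasDerivAt (fun y : ℝ => y * x) x t := by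
      simpa using (hasDerivAt_id t).mul_const x
    have h2 := ((contDiff_infty_iff_deriv.1 hf).1 (t*x)).hasDerivAt.comp t h1
    exact h2.congr_deriv (by ring)
  have h2 := intervalIntegral.integral_eq_sub_of_hasDerivAt h1
    ((continuous_const.mul (hd.continuous.comp
      (continuous_id.mul continuous_const))).intervalIntegrable _ _)
  simp only [intervalIntegral.integral_const_mul] at h2
  simp [h2, h0]

lemma even_step (f : ℝ → ℝ) (hf : ContDiff ℝ (⊤ : ℕ∞) f) (he : ∀ x, f x = f (-x)) :
    ∃ q : ℝ → ℝ, (ContDiff ℝ (⊤ : ℕ∞) q ∧ ∀ x, q x = q (-x)) ∧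
      ∀ x, HasDerivAt f (x * q x) x := by
  obtain ⟨hdf, hd⟩ := contDiff_infty_iff_deriv.1 hf
  have hodd : ∀ x, deriv f (-x) = - deriv f x := by
    intro x
    have h1 := deriv_comp_neg f x
    rw [show (fun x => f (-x)) = f from funext fun x => (he x).symm] at h1
    linarith
  have h0 : deriv f 0 = 0 := by have := hodd 0; simp at this; linarith
  obtain ⟨q, hq, hqx⟩ := hadamard _ hd h0
  refine ⟨q, ⟨hq, fun x => ?_⟩, fun x => ?_⟩
  · rcases eq_or_ne x 0 with rfl | hx
    · simp
    · have := hodd x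
      rw [hqx, hqx] at this
      apply mul_left_cancel₀ hx
      linarith
  · rw [← hqx]; exact (hdf x).hasDerivAt

lemma even_seq (f : ℝ → ℝ) (hf : ContDiff ℝ (⊤ : ℕ∞) f) (he : ∀ x, f x = f (-x)) :
    ∃ F : ℕ → ℝ → ℝ, F 0 = f ∧ ∀ k x, HasDerivAt (F k) (x * F (k+1) x) x := by
  let T := {f : ℝ → ℝ // ContDiff ℝ (⊤ : ℕ∞) f ∧ ∀ x, f x = f (-x)}
  have H : ∀ f : T, ∃ q : T, ∀ x, HasDerivAt f.1 (x * q.1 x) x := by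
    rintro ⟨f, hf, he⟩
    obtain ⟨q, hq, h⟩ := even_step f hf he
    exact ⟨⟨q, hq⟩, h⟩
  choose S hS using H
  refine ⟨fun k => (S^[k] ⟨f, hf, he⟩).1, rfl, fun k x => ?_⟩
  simp only [Function.iterate_succ_apply']
  exact hS _ x

open Filter Topology in
lemma borel_term (n : ℕ) (a : ℝ) : ∃ b : ℝ → ℝ, ContDiff ℝ (⊤ : ℕ∞) b ∧
    (∀ k, iteratedDeriv k b 0 = if k = n then a else 0) ∧
    (∀ k < n, ∀ x, ‖iteratedDeriv k b x‖ ≤ (1/2)^n) ∧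
    (∀ k, ∃ C, ∀ x, ‖iteratedDeriv k b x‖ ≤ C) := by
  let φ : ContDiffBump (0:ℝ) := ⟨1, 2, one_pos, one_lt_two⟩
  let ψ : ℝ → ℝ := fun x => x^n * φ x
  have hψ : ContDiff ℝ (⊤ : ℕ∞) ψ := (contDiff_id.pow n).mul φ.contDiff
  have hψs : HasCompactSupport ψ := φ.hasCompactSupport.mul_left
  have hb : ∀ k, ∃ C, ∀ x, ‖iteratedDeriv k ψ x‖ ≤ C := by
    intro k
    have hs : HasCompactSupport (iteratedDeriv k ψ) := by
      rw [iteratedDeriv_eq_iterate]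
      induction k with
      | zero => exact hψs
      | succ k ih => rw [Function.iterate_succ_apply']; exact ih.deriv
    have hc : Continuous (iteratedDeriv k ψ) :=
      continuous_iff_continuousAt.2 fun x => (hasDerivAt_iter ψ hψ k x).continuousAt
    exact hc.bounded_above_of_compact_support hs
  choose C hC using hb
  have hC0 : ∀ k, 0 ≤ C k := fun k => (norm_nonneg _).trans (hC k 0)
  have hψ0 : ∀ k, iteratedDeriv k ψ 0 = if k = n then (n.factorial : ℝ) else 0 := by
    intro k
    have : ψ =ᶠ[𝓝 0] fun x => x^n := by
      filter_upwards [φ.eventuallyEq_one] with x hx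
      simp [ψ, hx]
    rw [this.iteratedDeriv_eq k, iteratedDeriv_pow]
    rcases lt_trichotomy k n with h | h | h
    · simp [h.ne, (Nat.sub_pos_of_lt h).ne']
    · subst h; simp [Nat.descFactorial_self]
    · simp [h.ne', Nat.descFactorial_of_lt h]
  let c : ℝ := a / n.factorial
  let M : ℝ := ∑ k ∈ Finset.range n, C k
  have hM0 : 0 ≤ M := Finset.sum_nonneg fun k _ => hC0 k
  let L : ℝ := 1 + |c| * M * 2^n
  have hL1 : 1 ≤ L := by
    have : 0 ≤ |c| * M * 2^n := by positivity
    simp only [L]; linarith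
  have hL0 : 0 < L := by linarith
  have hit : ∀ k x, iteratedDeriv k (fun x => (c * (L^n)⁻¹) * ψ (L * x)) x
      = (c * (L^n)⁻¹) * (L^k * iteratedDeriv k ψ (L * x)) := by
    intro k x
    rw [iteratedDeriv_const_mul_field,
      iteratedDeriv_comp_const_mul (hψ.of_le (by exact_mod_cast le_top))]
  refine ⟨fun x => (c * (L^n)⁻¹) * ψ (L * x),
    contDiff_const.mul (hψ.comp (contDiff_const.mul contDiff_id)), ?_, ?_, ?_⟩
  · intro k
    rw [hit, mul_zero, hψ0]
    split_ifs with h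
    · subst h
      have : (k.factorial : ℝ) ≠ 0 := by positivity
      simp only [c]
      field_simp
    · simp
  · intro k hk x
    rw [hit, norm_mul, norm_mul, norm_mul]
    have h1 : ‖iteratedDeriv k ψ (L*x)‖ ≤ M := (hC k _).trans
      (Finset.single_le_sum (fun k _ => hC0 k) (Finset.mem_range.2 hk))
    have h2 : L^(k+1) ≤ L^n := pow_le_pow_right₀ hL1 hk
    have h3 : ‖(L^n)⁻¹‖ * ‖L^k‖ ≤ L⁻¹ := by
      rw [Real.norm_of_nonneg (by positivity), Real.norm_of_nonneg (by positivity),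
        inv_mul_le_iff₀ (by positivity), ← div_eq_mul_inv, le_div_iff₀ hL0, ← pow_succ]
      exact h2
    calc ‖c‖ * ‖(L^n)⁻¹‖ * (‖L^k‖ * ‖iteratedDeriv k ψ (L*x)‖)
        = ‖c‖ * (‖(L^n)⁻¹‖ * ‖L^k‖) * ‖iteratedDeriv k ψ (L*x)‖ := by ring
      _ ≤ ‖c‖ * L⁻¹ * M := by gcongr
      _ = (|c| * M) / L := by rw [Real.norm_eq_abs]; ring
      _ ≤ (1/2)^n := by
        rw [div_le_iff₀ hL0, one_div, inv_pow, ← div_eq_inv_mul, le_div_iff₀ (by positivity)]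
        simp only [L]; linarith
  · intro k
    refine ⟨‖c * (L^n)⁻¹‖ * (‖L^k‖ * C k), fun x => ?_⟩
    rw [hit, norm_mul, norm_mul (L^k)]
    gcongr
    exact hC k _

lemma borel_series (a : ℕ → ℝ) : ∃ h : ℝ → ℝ, ContDiff ℝ (⊤ : ℕ∞) h ∧
    ∀ k, iteratedDeriv k h 0 = a k := by
  choose b hb hb0 hbs C hC using fun n => borel_term n (a n)
  let v : ℕ → ℕ → ℝ := fun k n => if k < n then (1/2)^n else C n k
  have hv : ∀ k : ℕ, (k : ℕ∞) ≤ ⊤ → Summable (v k) := by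
    intro k _
    have h := (summable_geometric_two).congr_cofinite (g := v k) ?_
    · exact h
    · rw [Nat.cofinite_eq_atTop]
      filter_upwards [Filter.eventually_gt_atTop k] with n hn
      simp [v, hn]
  have hbd : ∀ (k n : ℕ) (x : ℝ), (k : ℕ∞) ≤ ⊤ → ‖iteratedFDeriv ℝ k (b n) x‖ ≤ v k n := by
    intro k n x _
    rw [norm_iteratedFDeriv_eq_norm_iteratedDeriv]
    simp only [v]
    split_ifs with h
    · exact hbs n k h x
    · exact hC n k x
  refine ⟨fun x => ∑' n, b n x, contDiff_tsum hb hv hbd, fun k => ?_⟩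
  have hs : Summable fun n => iteratedFDeriv ℝ k (b n) 0 :=
    .of_norm_bounded (hv k le_top) fun n => hbd k n 0 le_top
  rw [iteratedDeriv_eq_iteratedFDeriv, iteratedFDeriv_tsum_apply hb hv hbd le_top,
    ContinuousMultilinearMap.tsum_eval hs]
  simp only [← iteratedDeriv_eq_iteratedFDeriv, hb0]
  simp

open Filter Topology in
/-- Whitney's theorem on smooth even functions in one variable. -/
theorem whitney_even_one_var (f : ℝ → ℝ) (hf : ContDiff ℝ (⊤ : ℕ∞) f)
    (heven : ∀ x : ℝ, f x = f (-x)) :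
    ∃ g : ℝ → ℝ, ContDiff ℝ (⊤ : ℕ∞) g ∧ ∀ x : ℝ, f x = g (x ^ 2) := by
  obtain ⟨F, hF0, hF⟩ := even_seq f hf heven
  obtain ⟨h, hh, ha⟩ := borel_series (fun k => (1/2)^k * F k 0)
  have hFc : ∀ k, Continuous (F k) := fun k =>
    continuous_iff_continuousAt.2 fun x => (hF k x).continuousAt
  have hhc : ∀ k, Continuous (iteratedDeriv k h) := fun k =>
    continuous_iff_continuousAt.2 fun x => (hasDerivAt_iter h hh k x).continuousAt
  let G : ℕ → ℝ → ℝ := fun k t =>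
    if 0 ≤ t then (1/2)^k * F k (Real.sqrt t) else iteratedDeriv k h t
  have hGc : ∀ k, Continuous (G k) := by
    intro k
    refine Continuous.if_le (continuous_const.mul ((hFc k).comp Real.continuous_sqrt)) (hhc k)
      continuous_const continuous_id ?_
    intro x hx
    have hx' : x = 0 := hx.symm
    subst hx'
    simp [ha]
  have hG : ∀ k x, HasDerivAt (G k) (G (k+1) x) x := by
    intro k
    apply hasDerivAt_of_hasDerivAt_of_ne' (x := 0) _ (hGc k).continuousAt (hGc _).continuousAt
    intro y hy
    rcases lt_or_gt_of_ne hy with hy | hy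
    · have h1 : G (k+1) y = iteratedDeriv (k+1) h y := by simp [G, hy]
      rw [h1]
      refine (hasDerivAt_iter h hh k y).congr_of_eventuallyEq ?_
      filter_upwards [Iio_mem_nhds hy] with z hz
      have : ¬ (0 ≤ z) := not_le.2 hz
      simp [G, this]
    · have h1 : G (k+1) y = (1/2)^(k+1) * F (k+1) (Real.sqrt y) := by simp [G, hy.le]
      rw [h1]
      have h2 := ((hF k (Real.sqrt y)).comp y (Real.hasDerivAt_sqrt hy.ne')).const_mul ((1/2)^k)
      have h3 : Real.sqrt y ≠ 0 := (Real.sqrt_pos.2 hy).ne'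
      have h4 : HasDerivAt (fun z => (1/2)^k * F k (Real.sqrt z))
          ((1/2)^(k+1) * F (k+1) (Real.sqrt y)) y := by
        refine h2.congr_deriv ?_
        rw [pow_succ]
        field_simp
      refine h4.congr_of_eventuallyEq ?_
      filter_upwards [Ioi_mem_nhds hy] with z hz
      have : 0 ≤ z := le_of_lt hz
      simp [G, this]
  refine ⟨G 0, contDiff_of_seq G hG 0, fun x => ?_⟩
  simp only [G, sq_nonneg, if_true, pow_zero, one_mul, hF0, Real.sqrt_sq_eq_abs]
  rcases abs_choice x with h | h <;> rw [h]
  exact heven x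
end

section
/- For every smooth function f : ℝ² → ℝ which is even in both variables separately (f(x,y) = f(-x,y) and f(x,y) = f(x,-y) for all x,y), there exists a smooth function g : ℝ² → ℝ such that f(x,y) = g(x², y²) for all x,y ∈ ℝ. -/
open MeasureTheory Filter Topology
open scoped ContDiff

/-- Smooth with all derivatives bounded. -/
def BddSmooth (A : ℝ → ℝ) : Prop :=
  ContDiff ℝ ∞ A ∧ ∀ k : ℕ, ∃ M : ℝ, ∀ t, |iteratedDeriv k A t| ≤ M

lemma BddSmooth.deriv {A : ℝ → ℝ} (h : BddSmooth A) : BddSmooth (deriv A) := by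
  refine ⟨(contDiff_infty_iff_deriv.1 h.1).2, fun k => ?_⟩
  obtain ⟨M, hM⟩ := h.2 (k + 1)
  exact ⟨M, fun t => by rw [← iteratedDeriv_succ']; exact hM t⟩

lemma BddSmooth.bdd {A : ℝ → ℝ} (h : BddSmooth A) : ∃ M : ℝ, ∀ t, |A t| ≤ M := by
  simpa using h.2 0

lemma contDiff_param {W : Type*} [MeasurableSpace W] [TopologicalSpace W] [OpensMeasurableSpace W]
    [SecondCountableTopology W]
    (μ : Measure W) (α β : W → ℝ) (hα : Continuous α) (hβ : Continuous β) (n : ℕ) :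
    ∀ (A B : ℝ → ℝ) (a : W → ℝ), BddSmooth A → BddSmooth B →
    (∀ i j : ℕ, Integrable (fun w => α w ^ i * β w ^ j * a w) μ) →
    ContDiff ℝ n (fun p : ℝ × ℝ => ∫ w, A (p.1 * α w) * B (p.2 * β w) * a w ∂μ) := by
  have key : ∀ (A B : ℝ → ℝ) (a : W → ℝ), BddSmooth A → BddSmooth B →
    (∀ i j : ℕ, Integrable (fun w => α w ^ i * β w ^ j * a w) μ) → ∀ p : ℝ × ℝ,
    Integrable (fun w => A (p.1 * α w) * B (p.2 * β w) * a w) μ := by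
    intro A B a hA hB ha p
    obtain ⟨MA, hMA⟩ := hA.bdd
    obtain ⟨MB, hMB⟩ := hB.bdd
    have h0 : Integrable a μ := by simpa using ha 0 0
    have cA := hA.1.continuous
    have cB := hB.1.continuous
    refine Integrable.bdd_mul (c := MA * MB) h0 ?_ ?_
    · exact (Continuous.mul (by fun_prop) (by fun_prop)).aestronglyMeasurable
    · refine ae_of_all _ fun w => ?_
      rw [norm_mul]
      exact mul_le_mul (hMA _) (hMB _) (norm_nonneg _) ((abs_nonneg _).trans (hMA 0))
  have shiftα : ∀ a : W → ℝ, (∀ i j : ℕ, Integrable (fun w => α w ^ i * β w ^ j * a w) μ) →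
      (∀ i j : ℕ, Integrable (fun w => α w ^ i * β w ^ j * (α w * a w)) μ) := by
    intro a ha i j
    refine (ha (i+1) j).congr (ae_of_all _ fun w => ?_)
    simp only; ring
  have shiftβ : ∀ a : W → ℝ, (∀ i j : ℕ, Integrable (fun w => α w ^ i * β w ^ j * a w) μ) →
      (∀ i j : ℕ, Integrable (fun w => α w ^ i * β w ^ j * (β w * a w)) μ) := by
    intro a ha i j
    refine (ha i (j+1)).congr (ae_of_all _ fun w => ?_)
    simp only; ring
  have dkey : ∀ (A B : ℝ → ℝ) (a : W → ℝ), BddSmooth A → BddSmooth B →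
    (∀ i j : ℕ, Integrable (fun w => α w ^ i * β w ^ j * a w) μ) → ∀ p : ℝ × ℝ,
    HasFDerivAt (fun p : ℝ × ℝ => ∫ w, A (p.1 * α w) * B (p.2 * β w) * a w ∂μ)
      ((∫ w, deriv A (p.1 * α w) * B (p.2 * β w) * (α w * a w) ∂μ) •
          ContinuousLinearMap.fst ℝ ℝ ℝ +
       (∫ w, A (p.1 * α w) * deriv B (p.2 * β w) * (β w * a w) ∂μ) •
          ContinuousLinearMap.snd ℝ ℝ ℝ) p := by
    intro A B a hA hB ha p
    obtain ⟨MA, hMA⟩ := hA.bdd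
    obtain ⟨MB, hMB⟩ := hB.bdd
    obtain ⟨MA', hMA'⟩ := hA.deriv.bdd
    obtain ⟨MB', hMB'⟩ := hB.deriv.bdd
    have I1 := key _ _ _ hA.deriv hB (shiftα a ha)
    have I2 := key _ _ _ hA hB.deriv (shiftβ a ha)
    rw [← integral_smul_const (𝕜 := ℝ) (μ := μ) _ (ContinuousLinearMap.fst ℝ ℝ ℝ),
      ← integral_smul_const (𝕜 := ℝ) (μ := μ) _ (ContinuousLinearMap.snd ℝ ℝ ℝ), ← integral_add
      ((I1 p).smul_const _) ((I2 p).smul_const _)]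
    have iα : Integrable (fun w => α w * a w) μ := by simpa using ha 1 0
    have iβ : Integrable (fun w => β w * a w) μ := by simpa using ha 0 1
    have hmeas := (((I1 p).smul_const (ContinuousLinearMap.fst ℝ ℝ ℝ)).add
      ((I2 p).smul_const (ContinuousLinearMap.snd ℝ ℝ ℝ))).aestronglyMeasurable
    refine hasFDerivAt_integral_of_dominated_of_fderiv_le
      (F := fun (p : ℝ × ℝ) w => A (p.1 * α w) * B (p.2 * β w) * a w)
      (F' := fun p w => (deriv A (p.1 * α w) * B (p.2 * β w) * (α w * a w)) •
          ContinuousLinearMap.fst ℝ ℝ ℝ +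
       (A (p.1 * α w) * deriv B (p.2 * β w) * (β w * a w)) •
          ContinuousLinearMap.snd ℝ ℝ ℝ)
      (bound := fun w => MA' * MB * ‖α w * a w‖ + MA * MB' * ‖β w * a w‖)
      (s := Set.univ) univ_mem
      (Eventually.of_forall fun q => (key A B a hA hB ha q).aestronglyMeasurable)
      (key A B a hA hB ha p)
      hmeas ?_
      ((iα.norm.const_mul _).add (iβ.norm.const_mul _)) ?_
    · refine ae_of_all _ fun w q _ => ?_
      refine (norm_add_le _ _).trans (add_le_add ?_ ?_)
      · rw [norm_smul]
        refine (mul_le_of_le_one_right (norm_nonneg _) (ContinuousLinearMap.norm_fst_le ..)).trans ?_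
        rw [norm_mul, norm_mul]
        gcongr
        · exact (abs_nonneg _).trans (hMA' 0)
        · exact hMA' _
        · exact hMB _
      · rw [norm_smul]
        refine (mul_le_of_le_one_right (norm_nonneg _) (ContinuousLinearMap.norm_snd_le ..)).trans ?_
        rw [norm_mul, norm_mul]
        gcongr
        · exact (abs_nonneg _).trans (hMA 0)
        · exact hMA _
        · exact hMB' _
    · refine ae_of_all _ fun w q _ => ?_
      have dA : HasDerivAt A (deriv A (q.1 * α w)) (q.1 * α w) :=
        (hA.1.differentiable (by simp) _).hasDerivAt
      have dB : HasDerivAt B (deriv B (q.2 * β w)) (q.2 * β w) :=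
        (hB.1.differentiable (by simp) _).hasDerivAt
      have h1 : HasFDerivAt (fun q : ℝ × ℝ => q.1 * α w) (α w • ContinuousLinearMap.fst ℝ ℝ ℝ) q :=
        (hasFDerivAt_fst).mul_const (α w)
      have h2 : HasFDerivAt (fun q : ℝ × ℝ => q.2 * β w) (β w • ContinuousLinearMap.snd ℝ ℝ ℝ) q :=
        (hasFDerivAt_snd).mul_const (β w)
      have := ((dA.comp_hasFDerivAt q h1).mul (dB.comp_hasFDerivAt q h2)).mul_const (a w)
      refine this.congr_fderiv ?_
      ext <;> simp <;> ring
  induction n with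
  | zero =>
    intro A B a hA hB ha
    rw [Nat.cast_zero, contDiff_zero]
    exact continuous_iff_continuousAt.2 fun p => (dkey A B a hA hB ha p).continuousAt
  | succ n ih =>
    intro A B a hA hB ha
    push_cast
    rw [contDiff_succ_iff_hasFDerivAt]
    refine ⟨_, ?_, fun p => dkey A B a hA hB ha p⟩
    exact ((ih _ _ _ hA.deriv hB (shiftα a ha)).smul contDiff_const).add
      ((ih _ _ _ hA hB.deriv (shiftβ a ha)).smul contDiff_const)

lemma exists_entire_cos : ∃ c : ℝ → ℝ, ContDiff ℝ ∞ c ∧ ∀ x, c (x ^ 2) = Real.cos x := by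
  set u : ℕ → ℝ := fun n => (-1) ^ n / ((2 * n).factorial : ℝ) with hu
  have hrad : (FormalMultilinearSeries.ofScalars ℝ u).radius = ⊤ := by
    apply FormalMultilinearSeries.ofScalars_radius_eq_top_of_tendsto
    · refine Eventually.of_forall fun n => ?_
      simp only [hu]
      positivity
    · have : (fun n : ℕ => ‖u n.succ‖ / ‖u n‖) = fun n : ℕ => 1 / ((2 * (n:ℝ) + 2) * (2 * n + 1)) := by
        funext n
        have e : 2 * n.succ = 2 * n + 1 + 1 := by omega
        simp only [hu, e, Nat.factorial_succ]
        have := Nat.factorial_pos (2 * n)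
        have h' : ((2 * n).factorial : ℝ) ≠ 0 := by positivity
        simp only [norm_div, norm_pow, norm_neg, norm_one, one_pow]
        rw [Real.norm_of_nonneg (by positivity), Real.norm_of_nonneg (by positivity)]
        push_cast
        field_simp
        ring
      rw [this]
      refine squeeze_zero (fun n => by positivity) (fun n => ?_)
        tendsto_one_div_add_atTop_nhds_zero_nat
      apply one_div_le_one_div_of_le (by positivity)
      nlinarith [(Nat.cast_nonneg n : (0:ℝ) ≤ n)]
  have hps := (FormalMultilinearSeries.ofScalars ℝ u).hasFPowerSeriesOnBall (by rw [hrad]; simp)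
  rw [hrad] at hps
  refine ⟨(FormalMultilinearSeries.ofScalars ℝ u).sum, ?_, ?_⟩
  · rw [contDiff_iff_contDiffAt]
    intro x
    exact (hps.analyticAt_of_mem (by simp)).contDiffAt
  · intro x
    rw [FormalMultilinearSeries.sum, FormalMultilinearSeries.ofScalars_apply_eq',
      ← (Real.hasSum_cos x).tsum_eq]
    refine tsum_congr fun n => ?_
    simp only [hu, smul_eq_mul, pow_mul]
    ring

lemma iteratedDeriv_form (c : ℝ → ℝ) (hc : ∀ x, 0 ≤ x → c x = Real.cos √x) (k : ℕ) :
    ∃ p q : Polynomial ℝ, ∀ t, 0 < t → iteratedDeriv k c t =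
      Real.cos √t * p.eval (√t)⁻¹ + Real.sin √t * q.eval (√t)⁻¹ := by
  induction k with
  | zero => exact ⟨1, 0, fun t ht => by simp [hc t ht.le]⟩
  | succ k ih =>
    obtain ⟨p, q, h⟩ := ih
    refine ⟨Polynomial.C (1/2) * (Polynomial.X * q - Polynomial.X ^ 3 * p.derivative),
      Polynomial.C (-1/2) * (Polynomial.X * p + Polynomial.X ^ 3 * q.derivative), fun t ht => ?_⟩
    have hs : 0 < √t := Real.sqrt_pos.2 ht
    have h1 : HasDerivAt Real.sqrt (1 / (2 * √t)) t := Real.hasDerivAt_sqrt ht.ne'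
    have h2 := h1.inv hs.ne'
    have hd := (h1.cos.mul ((p.hasDerivAt (√t)⁻¹).comp t h2)).add
      (h1.sin.mul ((q.hasDerivAt (√t)⁻¹).comp t h2))
    rw [iteratedDeriv_succ]
    have he : iteratedDeriv k c =ᶠ[𝓝 t] fun t =>
      Real.cos √t * p.eval (√t)⁻¹ + Real.sin √t * q.eval (√t)⁻¹ := by
      filter_upwards [lt_mem_nhds ht] with x hx using h x hx
    rw [he.deriv_eq]
    refine hd.deriv.trans ?_
    simp only [Function.comp, Polynomial.eval_mul, Polynomial.eval_C, Polynomial.eval_sub,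
      Polynomial.eval_add, Polynomial.eval_X, Polynomial.eval_pow, Pi.inv_apply]
    field_simp
    ring

lemma exists_kernel : ∃ C : ℝ → ℝ, BddSmooth C ∧ ∀ x, C (x ^ 2) = Real.cos x := by
  obtain ⟨c, hc, hcos⟩ := exists_entire_cos
  set C : ℝ → ℝ := fun t => Real.smoothTransition (t + 1) * c t with hC
  have hCs : ContDiff ℝ ∞ C :=
    (Real.smoothTransition.contDiff.comp (contDiff_id.add contDiff_const)).mul hc
  have h0 : ∀ t, 0 ≤ t → C t = c t := fun t ht => by
    simp only [hC]
    rw [Real.smoothTransition.one_of_one_le (by linarith), one_mul]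
  have h1 : ∀ x, C (x ^ 2) = Real.cos x := fun x => by rw [h0 _ (sq_nonneg x), hcos]
  refine ⟨C, ⟨hCs, fun k => ?_⟩, h1⟩
  obtain ⟨p, q, hpq⟩ := iteratedDeriv_form C
    (fun x hx => by rw [← h1, Real.sq_sqrt hx]) k
  have hcont : Continuous (iteratedDeriv k C) := hCs.continuous_iteratedDeriv k (by exact_mod_cast le_top)
  obtain ⟨M1, hM1⟩ := (isCompact_Icc (a := (-2:ℝ)) (b := 1)).exists_bound_of_continuousOn
    hcont.continuousOn
  obtain ⟨Mp, hMp⟩ := (isCompact_Icc (a := (0:ℝ)) (b := 1)).exists_bound_of_continuousOn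
    p.continuous.continuousOn
  obtain ⟨Mq, hMq⟩ := (isCompact_Icc (a := (0:ℝ)) (b := 1)).exists_bound_of_continuousOn
    q.continuous.continuousOn
  refine ⟨max M1 (Mp + Mq), fun t => ?_⟩
  have hM10 : 0 ≤ M1 := (norm_nonneg _).trans (hM1 0 (by norm_num))
  rcases lt_or_ge t (-2) with ht | ht
  · have he : C =ᶠ[𝓝 t] fun _ => 0 := by
      filter_upwards [gt_mem_nhds ht] with x hx
      simp only [hC]
      rw [Real.smoothTransition.zero_of_nonpos (by linarith), zero_mul]
    rw [he.iteratedDeriv_eq k]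
    simp only [iteratedDeriv_const]
    split_ifs <;> simp [hM10]
  rcases le_or_gt t 1 with ht1 | ht1
  · exact (hM1 t ⟨ht, ht1⟩).trans (le_max_left _ _)
  · refine le_trans ?_ (le_max_right _ _)
    rw [hpq t (by linarith)]
    have hv : (√t)⁻¹ ∈ Set.Icc (0:ℝ) 1 :=
      ⟨by positivity, inv_le_one_of_one_le₀ (Real.one_le_sqrt.2 ht1.le)⟩
    refine (abs_add_le _ _).trans (add_le_add ?_ ?_)
    · rw [abs_mul]
      exact (mul_le_of_le_one_left (abs_nonneg _) (Real.abs_cos_le_one _)).trans (hMp _ hv)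
    · rw [abs_mul]
      exact (mul_le_of_le_one_left (abs_nonneg _) (Real.abs_sin_le_one _)).trans (hMq _ hv)

/-- The Euclidean plane. -/
abbrev PlaneW := EuclideanSpace ℝ (Fin 2)

lemma whitney_compact (f : ℝ × ℝ → ℝ) (hf : ContDiff ℝ ∞ f) (hc : HasCompactSupport f)
    (heven1 : ∀ x y : ℝ, f (x, y) = f (-x, y))
    (heven2 : ∀ x y : ℝ, f (x, y) = f (x, -y)) :
    ∃ g : ℝ × ℝ → ℝ, ContDiff ℝ ∞ g ∧ ∀ x y : ℝ, f (x, y) = g (x ^ 2, y ^ 2) := by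
  obtain ⟨C, hC, hcos⟩ := exists_kernel
  let e : PlaneW ≃L[ℝ] ℝ × ℝ :=
    (EuclideanSpace.equiv (Fin 2) ℝ).trans (ContinuousLinearEquiv.finTwoArrow ℝ ℝ)
  have he : ∀ v : PlaneW, e v = (v 0, v 1) := fun v => rfl
  let F : PlaneW → ℂ := fun v => (f (e v) : ℂ)
  have hFs : ContDiff ℝ ∞ F :=
    Complex.ofRealCLM.contDiff.comp (hf.comp e.contDiff)
  have hFc : HasCompactSupport F :=
    (hc.comp_homeomorph e.toHomeomorph).comp_left (g := fun x : ℝ => (x : ℂ)) (by simp)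
  let S : SchwartzMap PlaneW ℂ := hFc.toSchwartzMap hFs
  let G : SchwartzMap PlaneW ℂ := FourierTransform.fourier S
  have hinv : ∀ v : PlaneW, (f (e v) : ℂ) =
      ∫ w : PlaneW, Complex.exp (((2 * Real.pi * inner ℝ w v : ℝ) : ℂ) * Complex.I) • G w := by
    intro v
    have h1 : FourierTransformInv.fourierInv G = S := FourierTransform.fourierInv_fourier_eq S
    have h2 : (S v : ℂ) = FourierTransformInv.fourierInv (G : PlaneW → ℂ) v := by
      rw [← h1, SchwartzMap.fourierInv_coe]
    rw [Real.fourierInv_eq'] at h2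
    exact h2
  let a : PlaneW → ℝ := fun w => (G w).re
  let b : PlaneW → ℝ := fun w => (G w).im
  have hGi : Integrable G := G.integrable
  have haint : Integrable a := hGi.re
  have hbint : Integrable b := hGi.im
  let θ : ℝ → ℝ → PlaneW → ℝ := fun x y w => 2 * Real.pi * (x * w 0 + y * w 1)
  let J : ℝ → ℝ → PlaneW → ℝ := fun x y w => Real.cos (θ x y w) * a w - Real.sin (θ x y w) * b w
  have hJint : ∀ x y, Integrable (J x y) := by
    intro x y
    have cθ : Continuous (θ x y) := by fun_prop
    refine Integrable.sub (Integrable.bdd_mul (c := 1) haint ?_ ?_)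
      (Integrable.bdd_mul (c := 1) hbint ?_ ?_)
    · exact (Real.continuous_cos.comp cθ).aestronglyMeasurable
    · exact ae_of_all _ fun w => Real.abs_cos_le_one _
    · exact (Real.continuous_sin.comp cθ).aestronglyMeasurable
    · exact ae_of_all _ fun w => Real.abs_sin_le_one _
  have hfJ : ∀ x y, f (x, y) = ∫ w, J x y w := by
    intro x y
    have h := hinv (!₂[x, y])
    have hint : Integrable (fun w : PlaneW =>
        Complex.exp (((2 * Real.pi * inner ℝ w !₂[x, y] : ℝ) : ℂ) * Complex.I) • G w) := by
      refine Integrable.bdd_mul (c := 1) hGi ?_ ?_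
      · exact Continuous.aestronglyMeasurable (by fun_prop)
      · exact ae_of_all _ fun w => (Complex.norm_exp_ofReal_mul_I _).le
    have h3 := congrArg Complex.re h
    have h4 := Complex.reCLM.integral_comp_comm hint
    simp only [Complex.reCLM_apply] at h4
    rw [← h4, Complex.ofReal_re] at h3
    rw [he] at h3
    refine h3.trans (integral_congr_ae (ae_of_all _ fun w => ?_))
    have hin : inner ℝ w !₂[x, y] = x * w 0 + y * w 1 := by
      simp [PiLp.inner_apply, Fin.sum_univ_two]
    simp only [smul_eq_mul, Complex.mul_re, Complex.exp_ofReal_mul_I_re,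
      Complex.exp_ofReal_mul_I_im, hin]
    rfl
  let α : PlaneW → ℝ := fun w => (2 * Real.pi * w 0) ^ 2
  let β : PlaneW → ℝ := fun w => (2 * Real.pi * w 1) ^ 2
  have hα : Continuous α := by fun_prop
  have hβ : Continuous β := by fun_prop
  have hmom : ∀ i j : ℕ, Integrable (fun w => α w ^ i * β w ^ j * a w) := by
    intro i j
    have hm := (G.integrable_pow_mul volume (2 * i + 2 * j)).const_mul
      (((2 * Real.pi) ^ 2) ^ i * ((2 * Real.pi) ^ 2) ^ j)
    refine hm.mono' ?_ (ae_of_all _ fun w => ?_)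
    · exact ((hα.pow i).mul (hβ.pow j)).aestronglyMeasurable.mul haint.aestronglyMeasurable
    · have h0 : |w 0| ≤ ‖w‖ := PiLp.norm_apply_le w 0
      have h1 : |w 1| ≤ ‖w‖ := PiLp.norm_apply_le w 1
      have ha : |a w| ≤ ‖G w‖ := Complex.abs_re_le_norm _
      have hα' : |α w| ≤ (2 * Real.pi) ^ 2 * ‖w‖ ^ 2 := by
        simp only [α]
        rw [abs_of_nonneg (sq_nonneg _), mul_pow, ← sq_abs (w 0)]
        gcongr
      have hβ' : |β w| ≤ (2 * Real.pi) ^ 2 * ‖w‖ ^ 2 := by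
        simp only [β]
        rw [abs_of_nonneg (sq_nonneg _), mul_pow, ← sq_abs (w 1)]
        gcongr
      calc ‖α w ^ i * β w ^ j * a w‖ = |α w| ^ i * |β w| ^ j * |a w| := by
            simp [abs_mul, abs_pow]
        _ ≤ ((2 * Real.pi) ^ 2 * ‖w‖ ^ 2) ^ i * ((2 * Real.pi) ^ 2 * ‖w‖ ^ 2) ^ j * ‖G w‖ := by
            gcongr
        _ = _ := by ring
  refine ⟨fun p => ∫ w : PlaneW, C (p.1 * α w) * C (p.2 * β w) * a w, ?_, ?_⟩
  · exact contDiff_infty.2 fun n => contDiff_param volume α β hα hβ n C C a hC hC hmom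
  · intro x y
    have e1 : 4 * f (x, y) = f (x, y) + f (-x, y) + f (x, -y) + f (-x, -y) := by
      rw [← heven1 x (-y), ← heven1 x y, ← heven2 x y]; ring
    have i2 : Integrable (fun w => J x y w + J (-x) y w) := (hJint _ _).add (hJint _ _)
    have i3 : Integrable (fun w => J x y w + J (-x) y w + J x (-y) w) := i2.add (hJint _ _)
    rw [hfJ x y, hfJ (-x) y, hfJ x (-y), hfJ (-x) (-y),
      ← integral_add (hJint _ _) (hJint _ _),
      ← integral_add i2 (hJint _ _), ← integral_add i3 (hJint _ _),
      ← hfJ] at e1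
    have e2 : ∀ w, J x y w + J (-x) y w + J x (-y) w + J (-x) (-y) w =
        4 * (C (x ^ 2 * α w) * C (y ^ 2 * β w) * a w) := by
      intro w
      have c1 : C (x ^ 2 * α w) = Real.cos (2 * Real.pi * (x * w 0)) := by
        rw [← hcos]; congr 1; simp only [α]; ring
      have c2 : C (y ^ 2 * β w) = Real.cos (2 * Real.pi * (y * w 1)) := by
        rw [← hcos]; congr 1; simp only [β]; ring
      rw [c1, c2]
      simp only [J, θ, neg_mul, mul_add, mul_neg, Real.cos_add, Real.sin_add, Real.cos_neg,
        Real.sin_neg]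
      ring
    simp only [Pi.add_apply, e2] at e1
    rw [integral_const_mul] at e1
    linarith

open scoped Manifold

/-- Whitney's theorem for functions on ℝ² even in both variables. -/
theorem whitney_even_two_vars (f : ℝ × ℝ → ℝ) (hf : ContDiff ℝ (⊤ : ℕ∞) f)
    (heven1 : ∀ x y : ℝ, f (x, y) = f (-x, y))
    (heven2 : ∀ x y : ℝ, f (x, y) = f (x, -y)) :
    ∃ g : ℝ × ℝ → ℝ, ContDiff ℝ (⊤ : ℕ∞) g ∧ ∀ x y : ℝ, f (x, y) = g (x ^ 2, y ^ 2) := by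
  let t : ℝ × ℝ → Set ℝ := fun p => {v | ∀ x y : ℝ, (x ^ 2, y ^ 2) = p → v = f (x, y)}
  have ht : ∀ p, Convex ℝ (t p) := by
    intro p u hu v hv a b ha hb hab x y hxy
    rw [hu x y hxy, hv x y hxy, ← add_smul, hab, one_smul]
  have hloc : ∀ p : ℝ × ℝ, ∃ U ∈ 𝓝 p, ∃ g : ℝ × ℝ → ℝ,
      ContMDiffOn 𝓘(ℝ, ℝ × ℝ) 𝓘(ℝ, ℝ) ∞ g U ∧ ∀ q ∈ U, g q ∈ t q := by
    intro p
    let θ : ContDiffBump p := default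
    let F : ℝ × ℝ → ℝ := fun z => θ (z.1 ^ 2, z.2 ^ 2) * f z
    have hsq : ContDiff ℝ ∞ (fun z : ℝ × ℝ => (z.1 ^ 2, z.2 ^ 2)) := by fun_prop
    have hF : ContDiff ℝ ∞ F := (θ.contDiff.comp hsq).mul hf
    have hFc : HasCompactSupport F := by
      obtain ⟨R, hR⟩ := θ.hasCompactSupport.isCompact.isBounded.exists_norm_le
      refine HasCompactSupport.intro (K := Metric.closedBall 0 (1 + R))
        (isCompact_closedBall _ _) fun z hz => ?_
      by_contra hne
      have h1 : θ (z.1 ^ 2, z.2 ^ 2) ≠ 0 := left_ne_zero_of_mul hne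
      have h2 := hR _ (subset_tsupport _ h1)
      rw [Prod.norm_def, max_le_iff] at h2
      apply hz
      rw [mem_closedBall_zero_iff, Prod.norm_def, max_le_iff]
      simp only [Real.norm_eq_abs, abs_pow, sq_abs] at h2 ⊢
      constructor
      · nlinarith [h2.1, sq_abs z.1, sq_nonneg (|z.1| - 1)]
      · nlinarith [h2.2, sq_abs z.2, sq_nonneg (|z.2| - 1)]
    obtain ⟨g, hg, hgF⟩ := whitney_compact F hF hFc
      (fun x y => by simp only [F, neg_sq]; rw [heven1])
      (fun x y => by simp only [F, neg_sq]; rw [heven2])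
    refine ⟨{q | θ q = 1}, θ.eventuallyEq_one, g, hg.contMDiff.contMDiffOn, ?_⟩
    rintro q hq x y rfl
    rw [← hgF]
    simp only [F]
    rw [show θ (x ^ 2, y ^ 2) = 1 from hq, one_mul]
  obtain ⟨g, hg⟩ := exists_contMDiffMap_forall_mem_convex_of_local 𝓘(ℝ, ℝ × ℝ) ht hloc
  exact ⟨g, g.contMDiff.contDiff, fun x y => (hg _ x y rfl).symm⟩
end
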